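/- arXiv:2602.21981 — 6 statements merged into one kernel-verified Lean document; each statement's English description precedes it below -/
import Mathlib

section
/- Let T > 0, η > 0, β > 0, R > 0, let S be a nonempty subset of [0, T], and let f : ℝ → [0, ∞] be Lebesgue-measurable such that ∫_{(max(t−η, 0), t]} f dλ ≥ R · η^β for every t ∈ S. Then S can be covered by finitely many closed intervals of radius 5η, and the covering number satisfies N(S, 5η) · R · η^β ≤ ∫_{{x ∈ [0, T] : dist(x, S) ≤ η}} f dλ. (The Vitali covering estimate established in Step 2 of the proof of Theorem 3.6, inequality (4.x)/(3.x) of the paper.) -/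
open MeasureTheory Filter Set
open scoped ENNReal NNReal Topology

/-- The covering number `N(A, η)`: the least number of closed balls (closed intervals) of
radius `η` needed to cover `A ⊆ ℝ`, with value `∞` if no finite cover exists. -/
noncomputable def coverNum (A : Set ℝ) (η : ℝ) : ℝ≥0∞ :=
  sInf {n : ℝ≥0∞ | ∃ s : Finset ℝ, (s.card : ℝ≥0∞) = n ∧ A ⊆ ⋃ x ∈ s, Metric.closedBall x η}

/-- The upper `s`-dimensional Minkowski content of `A ⊆ ℝ`:
`M^s(A) = limsup_{η → 0⁺} η^s · N(A, η)`. -/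
noncomputable def mink (s : ℝ) (A : Set ℝ) : ℝ≥0∞ :=
  Filter.limsup (fun η : ℝ => ENNReal.ofReal (η ^ s) * coverNum A η)
    (nhdsWithin (0 : ℝ) (Set.Ioi 0))

theorem TotallyBounded.packingNumber_ne_top {X : Type*} [PseudoEMetricSpace X] {A : Set X}
    (hA : TotallyBounded A) {ε : ℝ≥0} (hε : ε ≠ 0) : Metric.packingNumber ε A ≠ ⊤ := by
  have hε2 : ε / 2 ≠ 0 := by simpa using hε
  obtain ⟨N, -, hN, hcov⟩ := Metric.exists_finite_isCover_of_totallyBounded hε2 hA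
  have h := (Metric.packingNumber_two_mul_le_externalCoveringNumber (ε / 2) A).trans
    hcov.externalCoveringNumber_le_encard
  rw [mul_div_cancel₀ ε two_ne_zero] at h
  exact ne_top_of_le_ne_top (Set.encard_ne_top_iff.mpr hN) h

theorem TotallyBounded.exists_finset_separated_cover {X : Type*} [PseudoMetricSpace X] {A : Set X}
    (hA : TotallyBounded A) {r : ℝ} (hr : 0 < r) :
    ∃ C : Finset X, (C : Set X) ⊆ A ∧ (C : Set X).Pairwise (fun x y ↦ r < dist x y) ∧
      A ⊆ ⋃ x ∈ C, Metric.closedBall x r := by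
  lift r to ℝ≥0 using hr.le
  have htop := hA.packingNumber_ne_top (ε := r) (by exact_mod_cast hr.ne')
  have hfin : (Metric.maximalSeparatedSet r A).Finite := by
    rw [← Set.encard_ne_top_iff, Metric.encard_maximalSeparatedSet htop]
    exact htop
  refine ⟨hfin.toFinset, ?_, ?_, ?_⟩
  · simpa using Metric.maximalSeparatedSet_subset
  · rw [hfin.coe_toFinset]
    intro x hx y hy hxy
    have h : (r : ℝ≥0∞) < edist x y := Metric.isSeparated_maximalSeparatedSet hx hy hxy
    rw [edist_nndist] at h
    rw [dist_nndist]
    exact_mod_cast h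
  · simpa using Metric.isCover_iff_subset_iUnion_closedBall.mp
      (Metric.isCover_maximalSeparatedSet htop)

theorem coverNum_le_card {A : Set ℝ} {r : ℝ} {C : Finset ℝ}
    (h : A ⊆ ⋃ x ∈ C, Metric.closedBall x r) : coverNum A r ≤ C.card :=
  sInf_le ⟨C, rfl, h⟩

theorem pairwiseDisjoint_Ioc_max_sub {C : Set ℝ} {r a : ℝ}
    (hC : C.Pairwise (fun x y ↦ r < dist x y)) :
    C.PairwiseDisjoint (fun t ↦ Set.Ioc (max (t - r) a) t) := by
  intro x hx y hy hxy
  have h : r < dist x y := hC hx hy hxy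
  rw [Real.dist_eq, lt_abs] at h
  refine Set.disjoint_left.mpr fun z hz hz' ↦ ?_
  have hzx := (le_max_left (x - r) a).trans_lt hz.1
  have hzy := (le_max_left (y - r) a).trans_lt hz'.1
  have := hz.2
  have := hz'.2
  rcases h with h | h <;> linarith

/-- The Vitali covering estimate of Step 2 of the proof of Theorem 3.6: if `S ⊆ [0, T]` is
nonempty and `f : ℝ → [0, ∞]` is measurable with `∫_{(max(t-η,0), t]} f ≥ R · η^β` for every
`t ∈ S`, then `S` is covered by finitely many closed intervals of radius `5η` and
`N(S, 5η) · R · η^β ≤ ∫_{{x ∈ [0,T] : dist(x, S) ≤ η}} f`. -/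
theorem coverNum_mul_le_lintegral
    (T η β R : ℝ) (hT : 0 < T) (hη : 0 < η) (hβ : 0 < β) (hR : 0 < R)
    (S : Set ℝ) (hS : S.Nonempty) (hST : S ⊆ Set.Icc 0 T)
    (f : ℝ → ℝ≥0∞) (hf : Measurable f)
    (hlow : ∀ t ∈ S,
      ENNReal.ofReal (R * η ^ β) ≤ ∫⁻ x in Set.Ioc (max (t - η) 0) t, f x) :
    coverNum S (5 * η) ≠ ⊤ ∧
      coverNum S (5 * η) * ENNReal.ofReal (R * η ^ β) ≤
        ∫⁻ x in {x : ℝ | x ∈ Set.Icc (0 : ℝ) T ∧ Metric.infDist x S ≤ η}, f x := by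
  have hbdd : TotallyBounded S := (isCompact_Icc.totallyBounded).subset hST
  obtain ⟨C, hCS, hsep, hcov⟩ := hbdd.exists_finset_separated_cover hη
  have hle : coverNum S (5 * η) ≤ C.card :=
    coverNum_le_card (hcov.trans (Set.iUnion₂_mono fun _ _ ↦
      Metric.closedBall_subset_closedBall (by linarith)))
  refine ⟨ne_top_of_le_ne_top (ENNReal.natCast_ne_top _) hle, ?_⟩
  calc coverNum S (5 * η) * ENNReal.ofReal (R * η ^ β)
      ≤ C.card * ENNReal.ofReal (R * η ^ β) := by gcongr
    _ = ∑ _t ∈ C, ENNReal.ofReal (R * η ^ β) := by rw [Finset.sum_const, nsmul_eq_mul]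
    _ ≤ ∑ t ∈ C, ∫⁻ x in Set.Ioc (max (t - η) 0) t, f x :=
      Finset.sum_le_sum fun t ht ↦ hlow t (hCS ht)
    _ = ∫⁻ x in ⋃ t ∈ C, Set.Ioc (max (t - η) 0) t, f x :=
      (lintegral_biUnion_finset (pairwiseDisjoint_Ioc_max_sub hsep)
        (fun _ _ ↦ measurableSet_Ioc) f).symm
    _ ≤ _ := by
      refine lintegral_mono_set (Set.iUnion₂_subset fun t ht x hx ↦ ?_)
      have htS : t ∈ S := hCS ht
      obtain ⟨hxη, hx0⟩ := max_lt_iff.mp hx.1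
      refine ⟨⟨hx0.le, hx.2.trans (hST htS).2⟩, (Metric.infDist_le_dist_of_mem htS).trans ?_⟩
      rw [Real.dist_eq, abs_le]
      constructor <;> linarith [hx.2]
end

section
/- Let T > 0, γ ∈ (0, 1), R > 0 and r > 0. Let S ⊆ [0, T] be closed and let f : ℝ → [0, ∞] be Lebesgue-measurable with ∫_{(0, T)} f dλ < ∞, and assume that for every t ∈ S and every η ∈ (0, r) one has ∫_{(max(t−η, 0), t]} f dλ ≥ R · η^{1−γ}. Then the upper (1−γ)-dimensional Minkowski content of S vanishes, i.e. limsup_{η → 0⁺} η^{1−γ} · N(S, η) = 0; consequently ℋ^{1−γ}(S) = 0 and dimH(S) ≤ 1 − γ. (The deterministic covering lemma underlying Steps 1–2 of the proof of Theorem 3.6 of the paper.) -/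
open MeasureTheory Filter Set
open scoped ENNReal NNReal Topology

/-- If every left interval `(t - η, t]` with `t ∈ S` has `ν`-measure at least `c`, then the compact
set `S` is covered by `n` closed balls of radius `η`, where `n * c` is at most the `ν`-measure of
the `η`-thickening of `S`. -/
theorem exists_finset_cover_card_mul_le (ν : Measure ℝ) {S : Set ℝ} (hS : IsCompact S) {η : ℝ}
    (hη : 0 < η) {c : ℝ≥0∞} (hc : ∀ t ∈ S, c ≤ ν (Ioc (t - η) t)) :
    ∃ F : Finset ℝ, S ⊆ ⋃ x ∈ F, Metric.closedBall x η ∧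
      F.card * c ≤ ν (Metric.cthickening η S) := by
  lift η to ℝ≥0 using hη.le
  have hη' : 0 < η := hη
  have hpack : Metric.packingNumber η S ≠ ⊤ := by
    obtain ⟨N, -, hN, hcov⟩ := Metric.exists_finite_isCover_of_totallyBounded
      (half_pos hη').ne' hS.totallyBounded
    have h := (Metric.packingNumber_two_mul_le_externalCoveringNumber (η / 2) S).trans
      hcov.externalCoveringNumber_le_encard
    rw [mul_div_cancel₀ _ two_ne_zero] at h
    exact (h.trans_lt hN.encard_lt_top).ne
  have hsub : Metric.maximalSeparatedSet η S ⊆ S := Metric.maximalSeparatedSet_subset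
  have hfin : (Metric.maximalSeparatedSet η S).Finite := by
    rw [← Set.encard_ne_top_iff, Metric.encard_maximalSeparatedSet hpack]
    exact hpack
  refine ⟨hfin.toFinset, ?_, ?_⟩
  · simpa using (Metric.isCover_maximalSeparatedSet hpack).subset_iUnion_closedBall
  · have hdisj : Set.PairwiseDisjoint (hfin.toFinset : Set ℝ) fun t ↦ Ioc (t - η) t := by
      intro x hx y hy hxy
      have hlt : (η : ℝ) < |x - y| := by
        have h : (η : ℝ≥0∞) < edist x y := Metric.isSeparated_maximalSeparatedSet
          (hfin.mem_toFinset.1 hx) (hfin.mem_toFinset.1 hy) hxy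
        rw [edist_nndist, ENNReal.coe_lt_coe, ← NNReal.coe_lt_coe, coe_nndist,
          Real.dist_eq] at h
        exact h
      refine Set.disjoint_left.2 fun z hzx hzy ↦ ?_
      rcases abs_cases (x - y) with h | h <;> linarith [hzx.1, hzx.2, hzy.1, hzy.2]
    calc (hfin.toFinset.card : ℝ≥0∞) * c
        = ∑ _t ∈ hfin.toFinset, c := by simp
      _ ≤ ∑ t ∈ hfin.toFinset, ν (Ioc (t - η) t) :=
          Finset.sum_le_sum fun t ht ↦ hc t (hsub (hfin.mem_toFinset.1 ht))
      _ = ν (⋃ t ∈ hfin.toFinset, Ioc (t - η) t) :=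
          (measure_biUnion_finset hdisj fun _ _ ↦ measurableSet_Ioc).symm
      _ ≤ ν (Metric.cthickening η S) := by
          refine measure_mono (iUnion₂_subset fun t ht z hz ↦ ?_)
          refine Metric.mem_cthickening_of_dist_le z t _ _ (hsub (hfin.mem_toFinset.1 ht)) ?_
          rw [Real.dist_eq, abs_le]
          constructor <;> linarith [hz.1, hz.2]

/-- If a finite measure `ν ≪ volume` gives mass at least `R * η ^ s`, `s < 1`, to all the intervals
`(t - η, t]` with `t` in the compact set `S` and `η` small, then `S` can be covered by `o(η ^ (-s))`
closed balls of radius `η` as `η → 0⁺`. -/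
theorem exists_finset_cover_tendsto_zero (ν : Measure ℝ) [IsFiniteMeasure ν] (hν : ν ≪ volume)
    {S : Set ℝ} (hS : IsCompact S) {s R : ℝ} (hs : s < 1) (hR : 0 < R)
    (hlow : ∀ᶠ η : ℝ in 𝓝[>] 0, ∀ t ∈ S, ENNReal.ofReal (R * η ^ s) ≤ ν (Ioc (t - η) t)) :
    ∃ F : ℝ → Finset ℝ, (∀ᶠ η : ℝ in 𝓝[>] 0, S ⊆ ⋃ x ∈ F η, Metric.closedBall x η) ∧
      Tendsto (fun η : ℝ ↦ ENNReal.ofReal (η ^ s) * (F η).card) (𝓝[>] 0) (𝓝 0) := by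
  have hF : ∀ η : ℝ, ∃ F : Finset ℝ, 0 < η →
      (∀ t ∈ S, ENNReal.ofReal (R * η ^ s) ≤ ν (Ioc (t - η) t)) →
      S ⊆ ⋃ x ∈ F, Metric.closedBall x η ∧
        F.card * ENNReal.ofReal (R * η ^ s) ≤ ν (Metric.cthickening η S) := by
    intro η
    by_cases h : 0 < η ∧ ∀ t ∈ S, ENNReal.ofReal (R * η ^ s) ≤ ν (Ioc (t - η) t)
    · obtain ⟨F, hF⟩ := exists_finset_cover_card_mul_le ν hS h.1 h.2
      exact ⟨F, fun _ _ ↦ hF⟩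
    · exact ⟨∅, fun h₁ h₂ ↦ absurd ⟨h₁, h₂⟩ h⟩
  choose F hF using hF
  have hR0 : ENNReal.ofReal R ≠ 0 := by simpa using hR
  have hcov : ∀ᶠ η : ℝ in 𝓝[>] 0, S ⊆ ⋃ x ∈ F η, Metric.closedBall x η := by
    filter_upwards [self_mem_nhdsWithin, hlow] with η hη h using (hF η hη h).1
  have hbound : ∀ᶠ η : ℝ in 𝓝[>] 0, ENNReal.ofReal (η ^ s) * (F η).card ≤
      ν (Metric.cthickening η S) / ENNReal.ofReal R := by
    filter_upwards [self_mem_nhdsWithin, hlow] with η hη h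
    rw [ENNReal.le_div_iff_mul_le (.inl hR0) (.inl ENNReal.ofReal_ne_top)]
    refine le_trans (le_of_eq ?_) (hF η hη h).2
    rw [ENNReal.ofReal_mul hR.le]
    ring
  have hvol : volume S = 0 := by
    have hle : ∀ᶠ η : ℝ in 𝓝[>] 0, volume S ≤
        ENNReal.ofReal (2 * η ^ (1 - s)) * (ν univ / ENNReal.ofReal R) := by
      filter_upwards [self_mem_nhdsWithin, hcov, hbound] with η (hη : 0 < η) h₁ h₂
      calc volume S ≤ volume (⋃ x ∈ F η, Metric.closedBall x η) := measure_mono h₁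
        _ ≤ ∑ x ∈ F η, volume (Metric.closedBall x η) := measure_biUnion_finset_le _ _
        _ = ENNReal.ofReal (2 * η ^ (1 - s)) * (ENNReal.ofReal (η ^ s) * (F η).card) := by
          have hpow : 2 * η ^ (1 - s) * η ^ s = 2 * η := by
            rw [mul_assoc, ← Real.rpow_add hη, sub_add_cancel, Real.rpow_one]
          simp_rw [Real.volume_closedBall]
          rw [Finset.sum_const, nsmul_eq_mul, ← mul_assoc,
            ← ENNReal.ofReal_mul (by positivity), hpow, mul_comm]
        _ ≤ _ := by
          gcongr
          exact h₂.trans (ENNReal.div_le_div_right (measure_mono (subset_univ _)) _)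
    have hlim : Tendsto (fun η : ℝ ↦ ENNReal.ofReal (2 * η ^ (1 - s)) *
        (ν univ / ENNReal.ofReal R)) (𝓝[>] 0) (𝓝 0) := by
      have h : Tendsto (fun η : ℝ ↦ 2 * η ^ (1 - s)) (𝓝[>] 0) (𝓝 0) := by
        have h' := ((Real.continuousAt_rpow_const 0 (1 - s) (.inr (by linarith))).tendsto.const_mul
          2).mono_left (nhdsWithin_le_nhds (s := Ioi 0))
        rwa [Real.zero_rpow (by linarith), mul_zero] at h'
      have h' := ENNReal.Tendsto.mul_const (b := ν univ / ENNReal.ofReal R)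
        (ENNReal.tendsto_ofReal h) (.inr (ENNReal.div_ne_top (measure_ne_top _ _) hR0))
      simpa using h'
    exact le_antisymm (ge_of_tendsto hlim hle) bot_le
  refine ⟨F, hcov, tendsto_of_tendsto_of_tendsto_of_le_of_le' tendsto_const_nhds ?_
    (Eventually.of_forall fun _ ↦ bot_le) hbound⟩
  have h := ENNReal.Tendsto.div_const ((tendsto_measure_cthickening_of_isCompact
    (μ := ν) hS).mono_left (nhdsWithin_le_nhds (s := Ioi 0))) (.inr hR0)
  simpa [hν hvol] using h

/-- Covers by `o(η ^ (-s))` balls of radius `η` force the `s`-dimensional Minkowski content to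
vanish. -/
theorem mink_eq_zero_of_cover {S : Set ℝ} {s : ℝ} {F : ℝ → Finset ℝ}
    (hcov : ∀ᶠ η : ℝ in 𝓝[>] 0, S ⊆ ⋃ x ∈ F η, Metric.closedBall x η)
    (hF : Tendsto (fun η : ℝ ↦ ENNReal.ofReal (η ^ s) * (F η).card) (𝓝[>] 0) (𝓝 0)) :
    mink s S = 0 := by
  refine le_antisymm ?_ bot_le
  rw [← hF.limsup_eq]
  refine limsup_le_limsup ?_
  filter_upwards [hcov] with η h
  gcongr
  exact sInf_le ⟨F η, rfl, h⟩

/-- Covers by `o(η ^ (-s))` balls of radius `η` force the `s`-dimensional Hausdorff measure to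
vanish. -/
theorem hausdorffMeasure_eq_zero_of_cover {S : Set ℝ} {s : ℝ} (hs : 0 ≤ s) {F : ℝ → Finset ℝ}
    (hcov : ∀ᶠ η : ℝ in 𝓝[>] 0, S ⊆ ⋃ x ∈ F η, Metric.closedBall x η)
    (hF : Tendsto (fun η : ℝ ↦ ENNReal.ofReal (η ^ s) * (F η).card) (𝓝[>] 0) (𝓝 0)) :
    μH[s] S = 0 := by
  have hdiam : Tendsto (fun η : ℝ ↦ ENNReal.ofReal (2 * η)) (𝓝[>] 0) (𝓝 0) := by
    have h : Tendsto (fun η : ℝ ↦ ENNReal.ofReal (2 * η)) (𝓝 0) (𝓝 (ENNReal.ofReal (2 * 0))) :=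
      ENNReal.tendsto_ofReal (tendsto_id.const_mul 2)
    simpa using h.mono_left (nhdsWithin_le_nhds (s := Ioi 0))
  have hle := Measure.hausdorffMeasure_le_liminf_sum (ι := fun η : ℝ ↦ F η) s S
    (fun η : ℝ ↦ ENNReal.ofReal (2 * η)) hdiam (fun η x ↦ Metric.closedBall (x : ℝ) η)
    (by
      filter_upwards [self_mem_nhdsWithin] with η hη x
      rw [Real.closedBall_eq_Icc, Real.ediam_Icc]
      exact ENNReal.ofReal_le_ofReal (by linarith))
    (by
      filter_upwards [hcov] with η h
      simpa [iUnion_subtype] using h)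
  have hlim : Tendsto (fun η : ℝ ↦ ∑ x : F η, Metric.ediam (Metric.closedBall (x : ℝ) η) ^ s)
      (𝓝[>] 0) (𝓝 0) := by
    have h := ENNReal.Tendsto.const_mul (a := ENNReal.ofReal (2 ^ s)) hF
      (.inr ENNReal.ofReal_ne_top)
    rw [mul_zero] at h
    refine h.congr' ?_
    filter_upwards [self_mem_nhdsWithin] with η (hη : 0 < η)
    have hd (x : ℝ) : Metric.ediam (Metric.closedBall x η) ^ s =
        ENNReal.ofReal (2 ^ s) * ENNReal.ofReal (η ^ s) := by
      rw [Real.closedBall_eq_Icc, Real.ediam_Icc, ENNReal.ofReal_rpow_of_nonneg (by linarith) hs,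
        ← ENNReal.ofReal_mul (by positivity), ← Real.mul_rpow two_pos.le hη.le]
      ring_nf
    simp_rw [hd]
    rw [Finset.sum_const, nsmul_eq_mul, Finset.card_univ, Fintype.card_coe]
    ring
  rw [hlim.liminf_eq] at hle
  exact le_antisymm hle bot_le

/-- The deterministic covering lemma underlying Steps 1–2 of the proof of Theorem 3.6:
if `S ⊆ [0,T]` is closed, `f : ℝ → [0,∞]` is measurable and integrable on `(0,T)`, and
`∫_{(max(t-η,0), t]} f ≥ R · η^{1-γ}` for all `t ∈ S` and `η ∈ (0, r)`, then the upper
`(1-γ)`-dimensional Minkowski content of `S` vanishes; consequently `ℋ^{1-γ}(S) = 0` and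
`dimH(S) ≤ 1 - γ`. -/
theorem mink_eq_zero_of_local_lower_bound
    (T γ R r : ℝ) (hT : 0 < T) (hγ0 : 0 < γ) (hγ1 : γ < 1) (hR : 0 < R) (hr : 0 < r)
    (S : Set ℝ) (hScl : IsClosed S) (hST : S ⊆ Set.Icc 0 T)
    (f : ℝ → ℝ≥0∞) (hf : Measurable f)
    (hfin : (∫⁻ x in Set.Ioo (0 : ℝ) T, f x) < ⊤)
    (hlow : ∀ t ∈ S, ∀ η : ℝ, 0 < η → η < r →
      ENNReal.ofReal (R * η ^ (1 - γ)) ≤ ∫⁻ x in Set.Ioc (max (t - η) 0) t, f x) :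
    mink (1 - γ) S = 0 ∧ μH[1 - γ] S = 0 ∧ dimH S ≤ ENNReal.ofReal (1 - γ) := by
  have hS : IsCompact S := isCompact_Icc.of_isClosed_subset hScl hST
  let ν : Measure ℝ := (volume.restrict (Ioo 0 T)).withDensity f
  have hνfin : IsFiniteMeasure ν := isFiniteMeasure_withDensity hfin.ne
  have hνac : ν ≪ volume :=
    (withDensity_absolutelyContinuous _ _).trans Measure.restrict_le_self.absolutelyContinuous
  have hνlow : ∀ᶠ η : ℝ in 𝓝[>] 0, ∀ t ∈ S,
      ENNReal.ofReal (R * η ^ (1 - γ)) ≤ ν (Ioc (t - η) t) := by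
    filter_upwards [Ioo_mem_nhdsGT hr] with η hη t ht
    refine (hlow t ht η hη.1 hη.2).trans ?_
    rw [withDensity_apply _ measurableSet_Ioc, Measure.restrict_restrict measurableSet_Ioc,
      ← setLIntegral_congr Ioo_ae_eq_Ioc]
    refine lintegral_mono_set fun x hx ↦ ?_
    obtain ⟨h₁, h₂⟩ := max_lt_iff.1 hx.1
    exact ⟨⟨h₁, hx.2.le⟩, h₂, hx.2.trans_le (hST ht).2⟩
  obtain ⟨F, hcov, hF⟩ := exists_finset_cover_tendsto_zero ν hνac hS (by linarith) hR hνlow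
  have hH := hausdorffMeasure_eq_zero_of_cover (sub_nonneg.2 hγ1.le) hcov hF
  refine ⟨mink_eq_zero_of_cover hcov hF, hH, dimH_le_of_hausdorffMeasure_ne_top ?_⟩
  rw [Real.coe_toNNReal _ (sub_nonneg.2 hγ1.le), hH]
  exact ENNReal.zero_ne_top
end

section
/- Let T > 0 and let E ⊆ ℝ be a set such that for Lebesgue-almost every t ∈ (0, T) there exists δ > 0 with the open interval (t, t + δ) contained in E. Then (0, T) \ E is Lebesgue-null, i.e. the Lebesgue outer measure of (0, T) \ E is zero. (The one-sided density argument constituting the proof of Theorem 3.8 of the paper.) -/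
open MeasureTheory Filter Set
open scoped ENNReal NNReal Topology

/-- The one-sided density argument constituting the proof of Theorem 3.8: if for
Lebesgue-almost every `t ∈ (0, T)` there exists `δ > 0` with `(t, t + δ) ⊆ E`, then
`(0, T) \ E` is Lebesgue-null. -/
theorem null_of_ae_right_nbhd_subset
    (T : ℝ) (hT : 0 < T) (E : Set ℝ)
    (h : volume {t : ℝ | t ∈ Set.Ioo (0 : ℝ) T ∧
        ¬ ∃ δ : ℝ, 0 < δ ∧ Set.Ioo t (t + δ) ⊆ E} = 0) :
    volume (Set.Ioo (0 : ℝ) T \ E) = 0 := by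
  set F := Set.Ioo (0 : ℝ) T \ E
  have hc := (countable_setOfPred_isolated_right_within (s := F)).measure_zero volume
  refine measure_mono_null (fun t ht => ?_) (measure_union_null h hc)
  by_cases hb : ∃ δ : ℝ, 0 < δ ∧ Set.Ioo t (t + δ) ⊆ E
  · obtain ⟨δ, hδ, hsub⟩ := hb
    refine Or.inr ⟨ht, ?_⟩
    rw [← empty_mem_iff_bot, mem_nhdsWithin]
    refine ⟨Set.Iio (t + δ), isOpen_Iio, by simpa using hδ, ?_⟩
    rintro x ⟨hx, hxF, htx⟩
    exact hxF.2 (hsub ⟨htx, hx⟩)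
  · exact Or.inl ⟨ht.1, hb⟩
end

section
/- Let (Ω, 𝒜, P) be a probability space, Z a normed space, ℓ ∈ [1, ∞), p ∈ (0, ∞) and e ∈ (0, 1/ℓ). Let u : [0, ∞) × Ω → Z be jointly strongly measurable with ∫_0^T E‖u(t, ·)‖_Z^ℓ dt < ∞ for every T > 0, and assume the quantified local solvability hypothesis: there exist C₀ > 0 and a set I₀ ⊆ (0, ∞) with Lebesgue-null complement in (0, ∞) such that for every t₀ ∈ I₀ there is a measurable τ_{t₀} : Ω → [0, ∞] satisfying (a) for P-a.e. ω the path s ↦ u(s, ω) is continuous on (t₀, τ_{t₀}(ω)), and (b) P(τ_{t₀} ≤ t₀ + γ) ≤ C₀ · γ^{p·e} · (1 + N^p) + P(‖u(t₀, ·)‖_Z > N) for all γ > 0 and N ≥ 0. Then for every ε ∈ (0, 1), every T > 0 and every δ ∈ (0, T), the upper (1 − ℓe)-dimensional Minkowski content of Sin^ε ∩ [δ, T] vanishes, i.e. limsup_{η → 0⁺} η^{1−ℓe} · N(Sin^ε ∩ [δ, T], η) = 0; moreover ℋ^{1−ℓe}(Sin) = 0 and dimH(Sin) ≤ 1 − ℓe.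 (This is the probabilistic core of Theorem 3.6 of the paper: the quantified hypothesis (a)–(b) is exactly what the strong weak–strong uniqueness assumption together with Proposition 4.1 supply, with e equal to the excess from criticality Exc_X and ℓe < 1 encoding spatial subcriticality and space–time supercriticality.) -/
open MeasureTheory Filter Set
open scoped ENNReal NNReal Topology

variable {Ω : Type*} [MeasurableSpace Ω] {Z : Type*} [NormedAddCommGroup Z]

/-- A time `t₀ > 0` is `ε`-regular for `u : [0,∞) × Ω → Z` if there are a time `t ∈ [0, t₀)`
and a measurable `τ : Ω → [0, ∞]` with `P(τ > t₀) > 1 - ε` such that, `P`-a.s., the path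
`s ↦ u(s, ω)` is continuous on the stochastic interval `(t, τ(ω))`. -/
def IsEpsRegular (P : Measure Ω) (u : ℝ → Ω → Z) (ε t₀ : ℝ) : Prop :=
  0 < t₀ ∧ ∃ t : ℝ, 0 ≤ t ∧ t < t₀ ∧ ∃ τ : Ω → ℝ≥0∞, Measurable τ ∧
    ENNReal.ofReal (1 - ε) < P {ω | ENNReal.ofReal t₀ < τ ω} ∧
    ∀ᵐ ω ∂P, ContinuousOn (fun s => u s ω) {s : ℝ | t < s ∧ ENNReal.ofReal s < τ ω}

/-- The set `Reg^ε` of `ε`-regular times. -/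
def regSet (P : Measure Ω) (u : ℝ → Ω → Z) (ε : ℝ) : Set ℝ :=
  {t₀ | IsEpsRegular P u ε t₀}

/-- The set `Sin^ε = [0, ∞) \ Reg^ε` of `ε`-singular times. -/
def sinSet (P : Measure Ω) (u : ℝ → Ω → Z) (ε : ℝ) : Set ℝ :=
  Set.Ici 0 \ regSet P u ε

/-- The set `Reg = ⋂_{ε ∈ (0,1)} Reg^ε` of regular times. -/
def regAll (P : Measure Ω) (u : ℝ → Ω → Z) : Set ℝ :=
  ⋂ ε ∈ Set.Ioo (0 : ℝ) 1, regSet P u ε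

/-- The set `Sin = [0, ∞) \ Reg` of singular times. -/
def sinAll (P : Measure Ω) (u : ℝ → Ω → Z) : Set ℝ :=
  Set.Ici 0 \ regAll P u

lemma mul_coverNum_le_of_isSeparated {A : Set ℝ} {η : ℝ} (hη : 0 ≤ η) {b M : ℝ≥0∞}
    (hb : b ≠ 0) (hM : M ≠ ⊤)
    (h : ∀ S : Finset ℝ, (S : Set ℝ) ⊆ A →
      Metric.IsSeparated (ENNReal.ofReal η) (S : Set ℝ) → b * S.card ≤ M) :
    b * coverNum A η ≤ M := by
  obtain ⟨n, hn⟩ := ENNReal.exists_nat_mul_gt hb hM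
  have hpack : Metric.packingNumber η.toNNReal A ≤ n := by
    refine iSup_le fun C => iSup_le fun hCA => iSup_le fun hC => ?_
    by_contra! hcon
    obtain ⟨D, hDC, hD⟩ := Set.exists_subset_encard_eq hcon.le
    have hDfin : D.Finite := Set.finite_of_encard_eq_coe hD
    have hcard : hDfin.toFinset.card = n := by
      rw [hDfin.encard_eq_coe_toFinset_card] at hD
      exact_mod_cast hD
    have := h hDfin.toFinset (by simpa using hDC.trans hCA)
      (by simpa [ENNReal.ofReal] using Metric.IsSeparated.subset hDC hC)
    rw [hcard, mul_comm] at this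
    exact absurd hn this.not_gt
  have htop : Metric.packingNumber η.toNNReal A ≠ ⊤ :=
    ne_top_of_le_ne_top (ENat.natCast_ne_top n) hpack
  set C := Metric.maximalSeparatedSet η.toNNReal A with hCdef
  have hCfin : C.Finite := by
    rw [← Set.encard_ne_top_iff, hCdef, Metric.encard_maximalSeparatedSet htop]
    exact htop
  have hcov := Metric.isCover_iff_subset_iUnion_closedBall.1
    (Metric.isCover_maximalSeparatedSet htop)
  have hle : coverNum A η ≤ hCfin.toFinset.card :=
    sInf_le ⟨hCfin.toFinset, rfl, by simpa [hη] using hcov⟩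
  refine le_trans (by gcongr) (h hCfin.toFinset ?_ ?_)
  · simpa using Metric.maximalSeparatedSet_subset
  · simpa [ENNReal.ofReal] using Metric.isSeparated_maximalSeparatedSet (ε := η.toNNReal)
      (A := A)

lemma mul_coverNum_le_setLIntegral {f : ℝ → ℝ≥0∞} (hf : Measurable f) {A : Set ℝ}
    {T η : ℝ} {a : ℝ≥0∞} (hη : 0 < η) (ha : a ≠ 0)
    (hA : ∀ t ∈ A, Ioo (t - η) t ⊆ Ioc 0 T)
    (hfA : ∀ t ∈ A, ∀ᵐ s, s ∈ Ioo (t - η) t → a ≤ f s)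
    (hfin : ∫⁻ t in Ioc 0 T, f t ≠ ⊤) :
    a * ENNReal.ofReal η * coverNum A η ≤
      ∫⁻ t in {t | a ≤ f t}, f t ∂(volume.restrict (Ioc 0 T)) := by
  have hmeas : MeasurableSet {t | a ≤ f t} := measurableSet_le measurable_const hf
  refine mul_coverNum_le_of_isSeparated hη.le (by simp [ha, hη])
    (ne_top_of_le_ne_top hfin (setLIntegral_le_lintegral _ _)) fun S hSA hS => ?_
  have hdisj : (S : Set ℝ).PairwiseDisjoint fun t => Ioo (t - η) t := by
    intro x hx y hy hxy
    have hsep : ENNReal.ofReal η < edist x y := hS hx hy hxy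
    rw [edist_dist, ENNReal.ofReal_lt_ofReal_iff_of_nonneg hη.le, Real.dist_eq] at hsep
    refine Set.disjoint_left.2 fun z hzx hzy => ?_
    simp only [mem_Ioo] at hzx hzy
    rcases abs_cases (x - y) with h | h <;> linarith
  calc a * ENNReal.ofReal η * S.card
      = ∑ t ∈ S, ∫⁻ _ in Ioo (t - η) t, a := by
        simp [mul_comm]
    _ ≤ ∑ t ∈ S, ∫⁻ s in Ioo (t - η) t, {t | a ≤ f t}.indicator f s := by
        refine Finset.sum_le_sum fun t ht => ?_
        refine lintegral_mono_ae ((ae_restrict_iff' measurableSet_Ioo).2 ?_)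
        filter_upwards [hfA t (hSA ht)] with s hs hst
        rw [Set.indicator_of_mem (show s ∈ {t | a ≤ f t} from hs hst)]
        exact hs hst
    _ = ∫⁻ s in ⋃ t ∈ S, Ioo (t - η) t, {t | a ≤ f t}.indicator f s :=
        (lintegral_biUnion_finset hdisj (fun _ _ => measurableSet_Ioo) _).symm
    _ ≤ ∫⁻ s in Ioc 0 T, {t | a ≤ f t}.indicator f s :=
        lintegral_mono_set (iUnion₂_subset fun t ht => hA t (hSA ht))
    _ = _ := lintegral_indicator hmeas f

lemma mink_eq_zero_of_eventually_le {f : ℝ → ℝ≥0∞} (hf : Measurable f) {A : Set ℝ}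
    {T K s : ℝ} (hK : 0 < K) (hs : s < 1)
    (hfin : ∫⁻ t in Ioc 0 T, f t ≠ ⊤)
    (hA : ∀ᶠ η in 𝓝[>] (0 : ℝ), ∀ t ∈ A, Ioo (t - η) t ⊆ Ioc 0 T ∧
      ∀ᵐ r, r ∈ Ioo (t - η) t → ENNReal.ofReal (K * η ^ (s - 1)) ≤ f r) :
    mink s A = 0 := by
  set a : ℝ → ℝ≥0∞ := fun η => ENNReal.ofReal (K * η ^ (s - 1)) with ha_def
  have ha : Tendsto a (𝓝[>] 0) (𝓝 ⊤) := by
    refine ENNReal.tendsto_ofReal_nhds_top.2 ?_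
    exact (tendsto_rpow_neg_nhdsGT_zero (by linarith)).const_mul_atTop hK
  have hvol : Tendsto ((volume.restrict (Ioc 0 T)) ∘ fun η => {t | a η ≤ f t})
      (𝓝[>] 0) (𝓝 0) := by
    have hlim : Tendsto (fun η => (∫⁻ t in Ioc 0 T, f t) / a η) (𝓝[>] 0) (𝓝 0) := by
      simpa using ENNReal.Tendsto.const_div ha (Or.inr hfin)
    refine tendsto_of_tendsto_of_tendsto_of_le_of_le' tendsto_const_nhds hlim
      (Eventually.of_forall fun _ => zero_le) ?_
    filter_upwards [self_mem_nhdsWithin] with η hη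
    have hpos : 0 < η := hη
    exact meas_ge_le_lintegral_div hf.aemeasurable
      (by simp only [ha_def, ne_eq, ENNReal.ofReal_eq_zero, not_le]; positivity)
      ENNReal.ofReal_ne_top
  have hint := tendsto_setLIntegral_zero hfin hvol
  have hint' : Tendsto (fun η => (ENNReal.ofReal K)⁻¹ *
      ∫⁻ t in {t | a η ≤ f t}, f t ∂(volume.restrict (Ioc 0 T))) (𝓝[>] 0) (𝓝 0) := by
    simpa using ENNReal.Tendsto.const_mul hint
      (Or.inr (ENNReal.inv_ne_top.2 (by simpa using hK)))
  refine (tendsto_of_tendsto_of_tendsto_of_le_of_le' tendsto_const_nhds hint'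
    (Eventually.of_forall fun _ => zero_le) ?_).limsup_eq
  filter_upwards [self_mem_nhdsWithin, hA] with η hη hAη
  have hpos : 0 < η := hη
  have key := mul_coverNum_le_setLIntegral hf (a := a η) hη
    (by simp only [ha_def, ne_eq, ENNReal.ofReal_eq_zero, not_le]; positivity)
    (fun t ht => (hAη t ht).1) (fun t ht => (hAη t ht).2) hfin
  have hmul : a η * ENNReal.ofReal η = ENNReal.ofReal K * ENNReal.ofReal (η ^ s) := by
    rw [← ENNReal.ofReal_mul hK.le, ← ENNReal.ofReal_mul (by positivity), mul_assoc,
      ← Real.rpow_add_one hpos.ne', sub_add_cancel]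
  rw [hmul, mul_assoc] at key
  rw [← ENNReal.div_eq_inv_mul, ENNReal.le_div_iff_mul_le (by simp [hK]) (by simp), mul_comm]
  exact key

lemma hausdorffMeasure_eq_zero_of_mink_eq_zero {s : ℝ} (hs : 0 < s) {A : Set ℝ}
    (h : mink s A = 0) : μH[s] A = 0 := by
  have hlim : Tendsto (fun η : ℝ => ENNReal.ofReal (η ^ s) * coverNum A η) (𝓝[>] 0) (𝓝 0) :=
    tendsto_of_le_liminf_of_limsup_le zero_le h.le
  have hcover : ∀ κ : ℝ≥0, 0 < κ → ∀ᶠ η in 𝓝[>] (0 : ℝ), ∃ S : Finset ℝ,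
      A ⊆ ⋃ x ∈ S, Metric.closedBall x η ∧ ENNReal.ofReal (η ^ s) * S.card ≤ κ := by
    intro κ hκ
    filter_upwards [self_mem_nhdsWithin, hlim.eventually_lt_const (ENNReal.coe_pos.2 hκ)]
      with η hη hlt
    have hpos : 0 < η ^ s := Real.rpow_pos_of_pos hη s
    have hne : ENNReal.ofReal (η ^ s) ≠ 0 := by simpa using hpos
    rw [mul_comm, ← ENNReal.lt_div_iff_mul_lt (Or.inl hne) (Or.inl ENNReal.ofReal_ne_top)] at hlt
    obtain ⟨_, ⟨S, rfl, hS⟩, hlt⟩ := sInf_lt_iff.1 hlt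
    refine ⟨S, hS, ?_⟩
    rw [ENNReal.lt_div_iff_mul_lt (Or.inl hne) (Or.inl ENNReal.ofReal_ne_top), mul_comm] at hlt
    exact hlt.le
  have hbound : ∀ κ : ℝ≥0, 0 < κ → μH[s] A ≤ ENNReal.ofReal (2 ^ s) * κ := by
    intro κ hκ
    have hc : ∀ η : ℝ, ∃ S : Finset ℝ, (∃ S : Finset ℝ,
      A ⊆ ⋃ x ∈ S, Metric.closedBall x η ∧ ENNReal.ofReal (η ^ s) * S.card ≤ κ) →
        A ⊆ ⋃ x ∈ S, Metric.closedBall x η ∧ ENNReal.ofReal (η ^ s) * S.card ≤ κ := by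
      intro η
      by_cases hex : ∃ S : Finset ℝ,
        A ⊆ ⋃ x ∈ S, Metric.closedBall x η ∧ ENNReal.ofReal (η ^ s) * S.card ≤ κ
      · exact hex.imp fun S hS _ => hS
      · exact ⟨∅, fun h => absurd h hex⟩
    choose S hS using hc
    have hr : Tendsto (fun η : ℝ => ENNReal.ofReal (2 * η)) (𝓝[>] 0) (𝓝 0) := by
      have : Tendsto (fun η : ℝ => ENNReal.ofReal (2 * η)) (𝓝 0) (𝓝 (ENNReal.ofReal (2 * 0))) :=
        (ENNReal.continuous_ofReal.comp (continuous_const.mul continuous_id)).tendsto 0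
      simpa using this.mono_left nhdsWithin_le_nhds
    have hdiam : ∀ η x : ℝ, Metric.ediam (Metric.closedBall x η) ≤ ENNReal.ofReal (2 * η) := by
      intro η x
      rw [Real.closedBall_eq_Icc, Real.ediam_Icc]
      exact ENNReal.ofReal_le_ofReal (by linarith)
    refine (Measure.hausdorffMeasure_le_liminf_sum s A (l := 𝓝[>] (0 : ℝ))
      (fun η => ENNReal.ofReal (2 * η)) hr
      (fun η (x : S η) => Metric.closedBall (x : ℝ) η)
      (Eventually.of_forall fun η x => hdiam η x) ?_).trans ?_
    · filter_upwards [hcover κ hκ] with η hη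
      simpa [Set.iUnion_subtype] using (hS η hη).1
    · refine liminf_le_of_frequently_le' (Eventually.frequently ?_)
      filter_upwards [self_mem_nhdsWithin, hcover κ hκ] with η hpos hη
      have hη0 : (0 : ℝ) ≤ η := le_of_lt hpos
      calc ∑ x : S η, Metric.ediam (Metric.closedBall (x : ℝ) η) ^ s
          ≤ ∑ _x : S η, ENNReal.ofReal (2 * η) ^ s :=
            Finset.sum_le_sum fun x _ => ENNReal.rpow_le_rpow (hdiam η x) hs.le
        _ = ENNReal.ofReal (2 ^ s) * (ENNReal.ofReal (η ^ s) * (S η).card) := by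
            rw [ENNReal.ofReal_rpow_of_nonneg (by positivity) hs.le,
              Real.mul_rpow (by norm_num) hη0, ENNReal.ofReal_mul (by positivity)]
            simp
            ring
        _ ≤ ENNReal.ofReal (2 ^ s) * κ := by gcongr; exact (hS η hη).2
  have hlim0 : Tendsto (fun κ : ℝ≥0 => ENNReal.ofReal (2 ^ s) * κ) (𝓝[>] 0) (𝓝 0) := by
    have : Tendsto (fun κ : ℝ≥0 => ENNReal.ofReal (2 ^ s) * κ) (𝓝 0)
        (𝓝 (ENNReal.ofReal (2 ^ s) * ((0 : ℝ≥0) : ℝ≥0∞))) :=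
      ENNReal.Tendsto.const_mul (ENNReal.continuous_coe.tendsto 0)
        (Or.inr ENNReal.ofReal_ne_top)
    simpa using this.mono_left nhdsWithin_le_nhds
  exact le_antisymm (ge_of_tendsto hlim0 (by
    filter_upwards [self_mem_nhdsWithin] with κ hκ using hbound κ hκ)) zero_le

lemma sinSet_anti (P : Measure Ω) (u : ℝ → Ω → Z) {ε ε' : ℝ} (h : ε ≤ ε') :
    sinSet P u ε' ⊆ sinSet P u ε := by
  rintro t ⟨ht, hreg⟩
  refine ⟨ht, fun hε => hreg ?_⟩
  obtain ⟨ht0, r, hr, hrt, τ, hτ, hP, hc⟩ := hε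
  exact ⟨ht0, r, hr, hrt, τ, hτ, (ENNReal.ofReal_le_ofReal (by linarith)).trans_lt hP, hc⟩

lemma sinAll_subset_iUnion (P : Measure Ω) (u : ℝ → Ω → Z) :
    sinAll P u ⊆ {0} ∪ ⋃ n : ℕ, sinSet P u (1 / (n + 2)) ∩ Icc (1 / (n + 2 : ℝ)) (n + 2) := by
  rintro t ⟨ht, hreg⟩
  rcases eq_or_lt_of_le (show (0 : ℝ) ≤ t from ht) with rfl | htpos
  · exact Or.inl rfl
  right
  simp only [regAll, mem_iInter, not_forall] at hreg
  obtain ⟨ε, hε, hεt⟩ := hreg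
  obtain ⟨n, hn⟩ := exists_nat_gt (max t (max (1 / t) (1 / ε)))
  simp only [max_lt_iff] at hn
  have hn1 : 1 / (n + 2 : ℝ) ≤ t := by
    rw [one_div_le (by positivity) htpos]; linarith
  have hn2 : 1 / (n + 2 : ℝ) ≤ ε := by
    rw [one_div_le (by positivity) hε.1]; linarith
  exact mem_iUnion.2 ⟨n, sinSet_anti P u hn2 ⟨ht, hεt⟩, hn1, by linarith⟩

lemma ofReal_le_measure_of_mem_sinSet {P : Measure Ω} [IsProbabilityMeasure P]
    {u : ℝ → Ω → Z} {ε t₀ t₁ : ℝ} (hε : ε ≤ 1) (ht₁ : t₁ ∈ sinSet P u ε)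
    (ht₀ : 0 ≤ t₀) (h : t₀ < t₁) {τ : Ω → ℝ≥0∞} (hτ : Measurable τ)
    (hcont : ∀ᵐ ω ∂P,
      ContinuousOn (fun s => u s ω) {s : ℝ | t₀ < s ∧ ENNReal.ofReal s < τ ω}) :
    ENNReal.ofReal ε ≤ P {ω | τ ω ≤ ENNReal.ofReal t₁} := by
  have hle : P {ω | ENNReal.ofReal t₁ < τ ω} ≤ ENNReal.ofReal (1 - ε) := by
    by_contra! hlt
    exact ht₁.2 ⟨ht₀.trans_lt h, t₀, ht₀, h, τ, hτ, hlt, hcont⟩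
  have hcompl : {ω | τ ω ≤ ENNReal.ofReal t₁} = {ω | ENNReal.ofReal t₁ < τ ω}ᶜ := by
    ext ω; simp
  rw [hcompl, prob_compl_eq_one_sub (measurableSet_lt measurable_const hτ)]
  refine le_trans ?_ (tsub_le_tsub_left hle 1)
  rw [← ENNReal.ofReal_one]
  rw [← ENNReal.ofReal_sub _ (by linarith)]
  simp

lemma half_le_measure_norm_gt {P : Measure Ω} [IsProbabilityMeasure P] {u : ℝ → Ω → Z}
    {p e C₀ c ε η t₀ t₁ : ℝ} (hp : 0 < p) (hC₀ : 0 ≤ C₀) (hc : 0 ≤ c) (hε : ε ≤ 1)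
    (hε0 : 0 ≤ ε) (hη : 0 < η) (hcε : C₀ * c ^ p = ε / 4) (hηc : η ^ e ≤ c)
    (ht₁ : t₁ ∈ sinSet P u ε) (ht₀ : 0 ≤ t₀) (h : t₀ < t₁) (hlt : t₁ ≤ t₀ + η)
    {τ : Ω → ℝ≥0∞} (hτ : Measurable τ)
    (hcont : ∀ᵐ ω ∂P,
      ContinuousOn (fun s => u s ω) {s : ℝ | t₀ < s ∧ ENNReal.ofReal s < τ ω})
    (hbound : ∀ γ N : ℝ, 0 < γ → 0 ≤ N →
      P {ω | τ ω ≤ ENNReal.ofReal (t₀ + γ)} ≤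
        ENNReal.ofReal (C₀ * γ ^ (p * e) * (1 + N ^ p)) + P {ω | N < ‖u t₀ ω‖}) :
    ENNReal.ofReal (ε / 2) ≤ P {ω | c * η ^ (-e) < ‖u t₀ ω‖} := by
  have hsmall : C₀ * η ^ (p * e) * (1 + (c * η ^ (-e)) ^ p) ≤ ε / 2 := by
    have h1 : η ^ (p * e) = (η ^ e) ^ p := by rw [mul_comm, Real.rpow_mul hη.le]
    have h2 : (c * η ^ (-e)) ^ p = c ^ p * ((η ^ e) ^ p)⁻¹ := by
      rw [Real.mul_rpow hc (by positivity), Real.rpow_neg hη.le,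
        Real.inv_rpow (by positivity)]
    have h3 : 0 < (η ^ e) ^ p := by positivity
    have h4 : C₀ * (η ^ e) ^ p ≤ C₀ * c ^ p := by gcongr
    rw [h1, h2]
    calc C₀ * (η ^ e) ^ p * (1 + c ^ p * ((η ^ e) ^ p)⁻¹)
        = C₀ * (η ^ e) ^ p + C₀ * c ^ p := by field_simp
      _ ≤ ε / 2 := by linarith
  have hmono : P {ω | τ ω ≤ ENNReal.ofReal t₁} ≤ P {ω | τ ω ≤ ENNReal.ofReal (t₀ + η)} :=
    measure_mono fun ω hω => le_trans hω (ENNReal.ofReal_le_ofReal hlt)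
  have hsum : ENNReal.ofReal ε ≤ ENNReal.ofReal (ε / 2) + P {ω | c * η ^ (-e) < ‖u t₀ ω‖} :=
    calc ENNReal.ofReal ε ≤ _ := ofReal_le_measure_of_mem_sinSet hε ht₁ ht₀ h hτ hcont
      _ ≤ _ := hmono
      _ ≤ _ := hbound η (c * η ^ (-e)) hη (by positivity)
      _ ≤ _ := by gcongr
  have hsplit : ENNReal.ofReal ε = ENNReal.ofReal (ε / 2) + ENNReal.ofReal (ε / 2) := by
    rw [← ENNReal.ofReal_add (by linarith) (by linarith), add_halves]
  rw [hsplit] at hsum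
  exact (ENNReal.add_le_add_iff_left ENNReal.ofReal_ne_top).1 hsum

lemma ofReal_rpow_mul_measure_norm_gt_le {P : Measure Ω} {v : Ω → Z}
    (hv : StronglyMeasurable v) {ℓ N : ℝ} (hℓ : 0 ≤ ℓ) (hN : 0 ≤ N) :
    ENNReal.ofReal (N ^ ℓ) * P {ω | N < ‖v ω‖} ≤ ∫⁻ ω, (‖v ω‖₊ : ℝ≥0∞) ^ ℓ ∂P := by
  refine le_trans ?_ (mul_meas_ge_le_lintegral (hv.enorm.pow_const ℓ) (ENNReal.ofReal (N ^ ℓ)))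
  gcongr with ω
  intro hω
  rw [← ENNReal.ofReal_rpow_of_nonneg hN hℓ]
  gcongr
  rw [← ofReal_norm]
  exact ENNReal.ofReal_le_ofReal hω.le

/-- The probabilistic core of Theorem 3.6 of the paper. Under a joint measurability and
`L^ℓ`-energy bound for `u`, and the quantified local solvability hypothesis (for a.e.
`t₀ > 0` there is a stopping-type time `τ_{t₀}` beyond which paths are regular, with
`P(τ_{t₀} ≤ t₀ + γ) ≤ C₀ γ^{pe}(1 + N^p) + P(‖u(t₀)‖ > N)`), for `e ∈ (0, 1/ℓ)` one has:
the upper `(1 - ℓe)`-dimensional Minkowski content of `Sin^ε ∩ [δ, T]` vanishes for every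
`ε ∈ (0,1)`, `0 < δ < T`; moreover `ℋ^{1-ℓe}(Sin) = 0` and `dimH(Sin) ≤ 1 - ℓe`. -/
theorem singular_times_fractal_bound
    (P : Measure Ω) [IsProbabilityMeasure P]
    (ℓ p e : ℝ) (hℓ : 1 ≤ ℓ) (hp : 0 < p) (he : 0 < e) (hel : e < 1 / ℓ)
    (u : ℝ → Ω → Z)
    (hmeas : StronglyMeasurable (fun q : ℝ × Ω => u q.1 q.2))
    (henergy : ∀ T : ℝ, 0 < T →
      (∫⁻ t in Set.Ioc (0 : ℝ) T, ∫⁻ ω, (‖u t ω‖₊ : ℝ≥0∞) ^ ℓ ∂P) < ⊤)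
    (C₀ : ℝ) (hC₀ : 0 < C₀)
    (I₀ : Set ℝ) (hI₀ : I₀ ⊆ Set.Ioi 0)
    (hI₀null : volume (Set.Ioi (0 : ℝ) \ I₀) = 0)
    (hloc : ∀ t₀ ∈ I₀, ∃ τ : Ω → ℝ≥0∞, Measurable τ ∧
      (∀ᵐ ω ∂P, ContinuousOn (fun s => u s ω) {s : ℝ | t₀ < s ∧ ENNReal.ofReal s < τ ω}) ∧
      ∀ γ N : ℝ, 0 < γ → 0 ≤ N →
        P {ω | τ ω ≤ ENNReal.ofReal (t₀ + γ)} ≤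
          ENNReal.ofReal (C₀ * γ ^ (p * e) * (1 + N ^ p)) + P {ω | N < ‖u t₀ ω‖}) :
    (∀ ε ∈ Set.Ioo (0 : ℝ) 1, ∀ T : ℝ, 0 < T → ∀ δ : ℝ, 0 < δ → δ < T →
      mink (1 - ℓ * e) (sinSet P u ε ∩ Set.Icc δ T) = 0) ∧
    μH[1 - ℓ * e] (sinAll P u) = 0 ∧
    dimH (sinAll P u) ≤ ENNReal.ofReal (1 - ℓ * e) := by
  have hℓ0 : 0 < ℓ := by linarith
  have hs0 : 0 < 1 - ℓ * e := by
    rw [lt_div_iff₀ hℓ0] at hel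
    linarith
  have hs1 : 1 - ℓ * e < 1 := by
    have := mul_pos hℓ0 he
    linarith
  have hfmeas : Measurable fun t => ∫⁻ ω, (‖u t ω‖₊ : ℝ≥0∞) ^ ℓ ∂P :=
    (hmeas.enorm.pow_const ℓ).lintegral_prod_right'
  have hsec : ∀ t, StronglyMeasurable (u t) := fun t =>
    hmeas.comp_measurable measurable_prodMk_left
  have hI₀ae : ∀ᵐ t : ℝ, 0 < t → t ∈ I₀ := by
    filter_upwards [measure_eq_zero_iff_ae_notMem.1 hI₀null] with t ht htpos
    by_contra hcon
    exact ht ⟨htpos, hcon⟩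
  have hmink : ∀ ε ∈ Set.Ioo (0 : ℝ) 1, ∀ T : ℝ, 0 < T → ∀ δ : ℝ, 0 < δ → δ < T →
      mink (1 - ℓ * e) (sinSet P u ε ∩ Set.Icc δ T) = 0 := by
    intro ε hε T hT δ hδ _
    have hε0 : 0 < ε := hε.1
    set c : ℝ := (ε / (4 * C₀)) ^ p⁻¹ with hc_def
    have hc : 0 < c := by positivity
    have hcε : C₀ * c ^ p = ε / 4 := by
      rw [hc_def, Real.rpow_inv_rpow (by positivity) hp.ne']
      field_simp
    refine mink_eq_zero_of_eventually_le hfmeas (T := T) (K := c ^ ℓ * (ε / 2))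
      (by positivity) hs1 (henergy T hT).ne ?_
    have hsmall : ∀ᶠ η in 𝓝[>] (0 : ℝ), η ^ e ≤ c := by
      have hlim : Tendsto (fun η : ℝ => η ^ e) (𝓝 0) (𝓝 0) := by
        simpa [Real.zero_rpow he.ne'] using
          (Real.continuousAt_rpow_const 0 e (Or.inr he.le)).tendsto
      exact (hlim.mono_left nhdsWithin_le_nhds).eventually_le_const hc
    filter_upwards [self_mem_nhdsWithin, hsmall, Ioo_mem_nhdsGT hδ] with η hη hηc hηδ
    have hηpos : 0 < η := hη
    rintro t₁ ⟨ht₁, hδt₁, ht₁T⟩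
    refine ⟨fun t ht => ⟨by linarith [ht.1, hηδ.2], by linarith [ht.2]⟩, ?_⟩
    filter_upwards [hI₀ae] with t₀ hmem ht₀
    have ht₀pos : 0 < t₀ := by linarith [ht₀.1, hηδ.2]
    obtain ⟨τ, hτ, hcont, hbound⟩ := hloc t₀ (hmem ht₀pos)
    have hhalf := half_le_measure_norm_gt hp hC₀.le hc.le hε.2.le hε0.le hηpos hcε hηc ht₁
      ht₀pos.le ht₀.2 (by linarith [ht₀.1]) hτ hcont hbound
    have hconst : c ^ ℓ * (ε / 2) * η ^ (1 - ℓ * e - 1) = (c * η ^ (-e)) ^ ℓ * (ε / 2) := by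
      rw [Real.mul_rpow hc.le (by positivity), ← Real.rpow_mul hηpos.le]
      ring_nf
    calc ENNReal.ofReal (c ^ ℓ * (ε / 2) * η ^ (1 - ℓ * e - 1))
        = ENNReal.ofReal ((c * η ^ (-e)) ^ ℓ) * ENNReal.ofReal (ε / 2) := by
          rw [hconst, ENNReal.ofReal_mul (by positivity)]
      _ ≤ ENNReal.ofReal ((c * η ^ (-e)) ^ ℓ) * P {ω | c * η ^ (-e) < ‖u t₀ ω‖} := by gcongr
      _ ≤ _ := ofReal_rpow_mul_measure_norm_gt_le (hsec t₀) hℓ0.le (by positivity)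
  have hH : μH[1 - ℓ * e] (sinAll P u) = 0 := by
    refine measure_mono_null (sinAll_subset_iUnion P u)
      (measure_union_null ?_ (measure_iUnion_null fun n => ?_))
    · have := Measure.nullSingletonClass_hausdorff ℝ hs0
      exact measure_singleton 0
    · have hn : (1 : ℝ) < n + 2 := by
        have : (0 : ℝ) ≤ n := n.cast_nonneg
        linarith
      have hn' : 1 / (n + 2 : ℝ) < 1 := by
        rw [div_lt_one (by linarith)]
        exact hn
      exact hausdorffMeasure_eq_zero_of_mink_eq_zero hs0
        (hmink _ ⟨by positivity, hn'⟩ _ (by linarith) _ (by positivity) (hn'.trans hn))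
  refine ⟨hmink, hH, dimH_le_of_hausdorffMeasure_ne_top (d := (1 - ℓ * e).toNNReal) ?_⟩
  rw [Real.coe_toNNReal _ hs0.le, hH]
  exact ENNReal.zero_ne_top
end

section
/- Let (Ω, 𝒜, P) be a probability space, Z a normed space, and u : [0, ∞) × Ω → Z a map. Assume there exists a set I₀ ⊆ (0, ∞) with Lebesgue-null complement in (0, ∞) such that for every t₀ ∈ I₀ there is a measurable τ_{t₀} : Ω → [0, ∞] with P(τ_{t₀} > t₀) = 1 and such that, for P-a.e. ω, the path s ↦ u(s, ω) is continuous on (t₀, τ_{t₀}(ω)). Then the set Sin of singular times of u has Lebesgue measure zero: λ(Sin ∩ (0, T)) = 0 for every T > 0, and hence λ(Sin) = 0. (This is the probabilistic core of Theorem 3.8 of the paper, the spatially critical case, where no energy bound is assumed.) -/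
open MeasureTheory Filter Set
open scoped ENNReal NNReal Topology

variable {Ω : Type*} [MeasurableSpace Ω] {Z : Type*} [NormedAddCommGroup Z]

/-- If `P(τ > t₀) > c`, then also `P(τ > r) > c` for some `r > t₀`. -/
theorem exists_gt_lt_measure_ofReal_lt (P : Measure Ω) (τ : Ω → ℝ≥0∞) {t₀ : ℝ} {c : ℝ≥0∞}
    (h : c < P {ω | ENNReal.ofReal t₀ < τ ω}) :
    ∃ r > t₀, c < P {ω | ENNReal.ofReal r < τ ω} := by
  obtain ⟨v, hv_anti, hv_gt, hv_lim⟩ := exists_seq_strictAnti_tendsto t₀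
  have hmono : Monotone fun n => {ω | ENNReal.ofReal (v n) < τ ω} := fun m n hmn ω hω =>
    (ENNReal.ofReal_le_ofReal (hv_anti.antitone hmn)).trans_lt hω
  have hunion : (⋃ n, {ω | ENNReal.ofReal (v n) < τ ω}) = {ω | ENNReal.ofReal t₀ < τ ω} := by
    ext ω
    simp only [mem_iUnion, mem_ofPred_eq]
    refine ⟨fun ⟨n, hn⟩ => (ENNReal.ofReal_le_ofReal (hv_gt n).le).trans_lt hn, fun hω => ?_⟩
    exact ((ENNReal.tendsto_ofReal hv_lim).eventually (gt_mem_nhds hω)).exists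
  have hlim := tendsto_measure_iUnion_atTop (μ := P) hmono
  rw [hunion] at hlim
  obtain ⟨n, hn⟩ := (hlim.eventually (lt_mem_nhds h)).exists
  exact ⟨v n, hv_gt n, hn⟩

/-- Local continuity from time `t₀` on, up to a random time which exceeds `t₀` with probability
greater than `1 - ε`, makes all times shortly after `t₀` `ε`-regular. -/
theorem regSet_mem_nhdsGT {P : Measure Ω} {u : ℝ → Ω → Z} {ε t₀ : ℝ} (ht₀ : 0 ≤ t₀)
    {τ : Ω → ℝ≥0∞} (hτ : Measurable τ)
    (hP : ENNReal.ofReal (1 - ε) < P {ω | ENNReal.ofReal t₀ < τ ω})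
    (hcont : ∀ᵐ ω ∂P,
      ContinuousOn (fun s => u s ω) {s : ℝ | t₀ < s ∧ ENNReal.ofReal s < τ ω}) :
    regSet P u ε ∈ 𝓝[>] t₀ := by
  obtain ⟨r, hr, hPr⟩ := exists_gt_lt_measure_ofReal_lt P τ hP
  filter_upwards [Ioo_mem_nhdsGT hr] with s hs
  refine ⟨ht₀.trans_lt hs.1, t₀, ht₀, hs.1, τ, hτ, hPr.trans_le (measure_mono fun ω hω => ?_),
    hcont⟩
  exact (ENNReal.ofReal_le_ofReal hs.2.le).trans_lt hω

theorem regSet_mono (P : Measure Ω) (u : ℝ → Ω → Z) : Monotone (regSet P u) := by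
  rintro ε ε' h t₀ ⟨h0, t, ht, htt, τ, hτ, hP, hc⟩
  exact ⟨h0, t, ht, htt, τ, hτ, (ENNReal.ofReal_le_ofReal (by linarith)).trans_lt hP, hc⟩

/-- Every singular time is `1 / (n + 1)`-singular for some `n`. -/
theorem sinAll_subset_iUnion_sinSet (P : Measure Ω) (u : ℝ → Ω → Z) :
    sinAll P u ⊆ ⋃ n : ℕ, sinSet P u (1 / ((n : ℝ) + 1)) := by
  rintro t ⟨ht, hreg⟩
  simp only [regAll, mem_iInter, not_forall] at hreg
  obtain ⟨ε, hε, hreg⟩ := hreg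
  obtain ⟨n, hn⟩ := exists_nat_one_div_lt hε.1
  exact mem_iUnion.2 ⟨n, ht, fun h => hreg (regSet_mono P u hn.le h)⟩

/-- If `s` contains a right neighbourhood of each point of `A`, then `A \ s` is countable. -/
theorem countable_diff_of_mem_nhdsGT {A s : Set ℝ} (h : ∀ x ∈ A, s ∈ 𝓝[>] x) :
    (A \ s).Countable := by
  refine (countable_setOfPred_isolated_right_within (s := A \ s)).mono fun x hx => ?_
  refine mem_ofPred_eq.symm ▸ And.intro hx ?_
  rw [← empty_mem_iff_bot, inter_comm, nhdsWithin_inter']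
  filter_upwards [mem_inf_of_left (h x hx.1), mem_inf_of_right (mem_principal_self _)] with y hy hyA
  exact hyA.2 hy

/-- The probabilistic core of Theorem 3.8 of the paper (the spatially critical case): if for
a.e. `t₀ > 0` there is a measurable `τ_{t₀} : Ω → [0, ∞]` with `P(τ_{t₀} > t₀) = 1` such that
`P`-a.s. the path `s ↦ u(s, ω)` is continuous on `(t₀, τ_{t₀}(ω))`, then the set `Sin` of
singular times of `u` has Lebesgue measure zero. -/
theorem singular_times_null_critical
    (P : Measure Ω) [IsProbabilityMeasure P] (u : ℝ → Ω → Z)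
    (I₀ : Set ℝ) (hI₀ : I₀ ⊆ Set.Ioi 0)
    (hI₀null : volume (Set.Ioi (0 : ℝ) \ I₀) = 0)
    (hloc : ∀ t₀ ∈ I₀, ∃ τ : Ω → ℝ≥0∞, Measurable τ ∧
      P {ω | ENNReal.ofReal t₀ < τ ω} = 1 ∧
      ∀ᵐ ω ∂P, ContinuousOn (fun s => u s ω) {s : ℝ | t₀ < s ∧ ENNReal.ofReal s < τ ω}) :
    (∀ T : ℝ, 0 < T → volume (sinAll P u ∩ Set.Ioo 0 T) = 0) ∧
    volume (sinAll P u) = 0 := by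
  have hnull : volume (sinAll P u) = 0 := by
    refine measure_mono_null (sinAll_subset_iUnion_sinSet P u) (measure_iUnion_null fun n => ?_)
    have hn : (0 : ℝ) < 1 / ((n : ℝ) + 1) := by positivity
    have hcount : (I₀ \ regSet P u (1 / ((n : ℝ) + 1))).Countable := by
      refine countable_diff_of_mem_nhdsGT fun t₀ ht₀ => ?_
      obtain ⟨τ, hτ, hP, hcont⟩ := hloc t₀ ht₀
      refine regSet_mem_nhdsGT (hI₀ ht₀).le hτ ?_ hcont
      rw [hP, ENNReal.ofReal_lt_one]
      linarith
    refine measure_mono_null (t := {0} ∪ (Ioi 0 \ I₀) ∪ (I₀ \ regSet P u (1 / ((n : ℝ) + 1))))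
      ?_ (measure_union_null (measure_union_null Real.volume_singleton hI₀null)
        (hcount.measure_zero _))
    rintro t ⟨ht, hreg⟩
    by_cases htI : t ∈ I₀
    · exact Or.inr ⟨htI, hreg⟩
    · rcases (mem_Ici.1 ht).eq_or_lt with rfl | ht'
      · exact Or.inl (Or.inl rfl)
      · exact Or.inl (Or.inr ⟨ht', htI⟩)
  exact ⟨fun T _ => measure_mono_null inter_subset_left hnull, hnull⟩
end

section
/- Let (Ω, 𝒜, P) be a probability space, Z a normed space, ℓ ∈ [1, ∞), p ∈ (0, ∞) and e ∈ (0, 1/ℓ). Let u : [0, ∞) × Ω → Z be jointly strongly measurable with ∫_0^T E‖u(t, ·)‖_Z^ℓ dt < ∞ for every T > 0, and assume the quantified local solvability hypothesis: there exist C₀ > 0 and a set I₀ ⊆ (0, ∞) with Lebesgue-null complement in (0, ∞) such that for every t₀ ∈ I₀ there is a measurable τ_{t₀} : Ω → [0, ∞] satisfying (a) for P-a.e. ω the path s ↦ u(s, ω) is continuous on (t₀, τ_{t₀}(ω)), and (b) P(τ_{t₀} ≤ t₀ + γ) ≤ C₀ · γ^{p·e} · (1 + N^p) + P(‖u(t₀,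 ·)‖_Z > N) for all γ > 0 and N ≥ 0. Then for every ε ∈ (0, 1) and T > 0 there exist constants R > 0 and r ∈ (0, T) such that for every η ∈ (0, r) and every ε-singular time t ∈ Sin^ε with η ≤ t ≤ T one has ∫_{t−η}^{t} E‖u(t₀, ·)‖_Z^ℓ dt₀ ≥ R · η^{1−ℓe}. (Step 1 of the proof of Theorem 3.6 of the paper: ε-singular times force a quantified local blow-up of the energy integral.) -/
open MeasureTheory Filter Set
open scoped ENNReal NNReal Topology

variable {Ω : Type*} [MeasurableSpace Ω] {Z : Type*} [NormedAddCommGroup Z]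

/-- If `t` is `ε`-singular, a path that is continuous on `(s, τ)` with `s < t` must satisfy
`τ ≤ t` with probability at least `ε`. -/
theorem ofReal_le_measure_le_of_mem_sinSet {P : Measure Ω} [IsProbabilityMeasure P]
    {u : ℝ → Ω → Z} {ε s t : ℝ} (hε₀ : 0 ≤ ε) (hε₁ : ε ≤ 1) (ht : t ∈ sinSet P u ε) (hs : 0 ≤ s)
    (hst : s < t) {τ : Ω → ℝ≥0∞} (hτ : Measurable τ)
    (hcont : ∀ᵐ ω ∂P, ContinuousOn (fun s => u s ω) {r : ℝ | s < r ∧ ENNReal.ofReal r < τ ω}) :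
    ENNReal.ofReal ε ≤ P {ω | τ ω ≤ ENNReal.ofReal t} := by
  have hle : P {ω | ENNReal.ofReal t < τ ω} ≤ ENNReal.ofReal (1 - ε) := by
    by_contra! h
    exact ht.2 ⟨hs.trans_lt hst, s, hs, hst, τ, hτ, h, hcont⟩
  have hcompl : {ω | ENNReal.ofReal t < τ ω} = {ω | τ ω ≤ ENNReal.ofReal t}ᶜ := by
    ext ω
    simp
  rw [hcompl, prob_compl_eq_one_sub (measurableSet_le hτ measurable_const),
    tsub_le_iff_left] at hle
  refine (ENNReal.add_le_add_iff_right (a := ENNReal.ofReal (1 - ε)) ENNReal.ofReal_ne_top).1 ?_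
  rw [← ENNReal.ofReal_add hε₀ (by linarith)]
  simpa using hle

/-- Markov's inequality for the `ℓ`-th moment of the norm. -/
theorem ofReal_rpow_mul_measure_lt_norm_le_lintegral {P : Measure Ω} {f : Ω → Z}
    (hf : StronglyMeasurable f) {N ℓ : ℝ} (hN : 0 ≤ N) (hℓ : 0 ≤ ℓ) :
    ENNReal.ofReal (N ^ ℓ) * P {ω | N < ‖f ω‖} ≤ ∫⁻ ω, (‖f ω‖₊ : ℝ≥0∞) ^ ℓ ∂P := by
  refine le_trans ?_ (mul_meas_ge_le_lintegral (hf.enorm.pow_const ℓ) (ENNReal.ofReal (N ^ ℓ)))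
  gcongr with ω
  intro hω
  rw [← ENNReal.ofReal_rpow_of_nonneg hN hℓ, ← ofReal_norm]
  gcongr

/-- Step 1 of the proof of Theorem 3.6 of the paper: under the energy bound and the quantified
local solvability hypothesis, `ε`-singular times force a quantified local blow-up of the
energy integral: for every `ε ∈ (0,1)` and `T > 0` there are `R > 0` and `r ∈ (0, T)` such
that `∫_{t-η}^t E‖u(t₀)‖^ℓ dt₀ ≥ R η^{1-ℓe}` for every `η ∈ (0, r)` and every `t ∈ Sin^ε`
with `η ≤ t ≤ T`. -/
theorem singular_times_energy_lower_bound
    (P : Measure Ω) [IsProbabilityMeasure P]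
    (ℓ p e : ℝ) (hℓ : 1 ≤ ℓ) (hp : 0 < p) (he : 0 < e) (hel : e < 1 / ℓ)
    (u : ℝ → Ω → Z)
    (hmeas : StronglyMeasurable (fun q : ℝ × Ω => u q.1 q.2))
    (henergy : ∀ T : ℝ, 0 < T →
      (∫⁻ t in Set.Ioc (0 : ℝ) T, ∫⁻ ω, (‖u t ω‖₊ : ℝ≥0∞) ^ ℓ ∂P) < ⊤)
    (C₀ : ℝ) (hC₀ : 0 < C₀)
    (I₀ : Set ℝ) (hI₀ : I₀ ⊆ Set.Ioi 0)
    (hI₀null : volume (Set.Ioi (0 : ℝ) \ I₀) = 0)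
    (hloc : ∀ t₀ ∈ I₀, ∃ τ : Ω → ℝ≥0∞, Measurable τ ∧
      (∀ᵐ ω ∂P, ContinuousOn (fun s => u s ω) {s : ℝ | t₀ < s ∧ ENNReal.ofReal s < τ ω}) ∧
      ∀ γ N : ℝ, 0 < γ → 0 ≤ N →
        P {ω | τ ω ≤ ENNReal.ofReal (t₀ + γ)} ≤
          ENNReal.ofReal (C₀ * γ ^ (p * e) * (1 + N ^ p)) + P {ω | N < ‖u t₀ ω‖}) :
    ∀ ε ∈ Set.Ioo (0 : ℝ) 1, ∀ T : ℝ, 0 < T →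
      ∃ R : ℝ, 0 < R ∧ ∃ r : ℝ, 0 < r ∧ r < T ∧
        ∀ η : ℝ, 0 < η → η < r → ∀ t ∈ sinSet P u ε, η ≤ t → t ≤ T →
          ENNReal.ofReal (R * η ^ (1 - ℓ * e)) ≤
            ∫⁻ t₀ in Set.Ioc (t - η) t, ∫⁻ ω, (‖u t₀ ω‖₊ : ℝ≥0∞) ^ ℓ ∂P := by
  intro ε hε T hT
  obtain ⟨hε0, hε1⟩ := hε
  have hpe : 0 < p * e := mul_pos hp he
  set δ : ℝ := ε / (4 * C₀) with hδ_def
  have hδ : 0 < δ := by positivity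
  have hCδ : C₀ * δ = ε / 4 := by rw [hδ_def]; field_simp
  set c : ℝ := δ ^ p⁻¹ with hc_def
  have hc : 0 < c := Real.rpow_pos_of_pos hδ _
  have hr₀ : 0 < δ ^ (p * e)⁻¹ := Real.rpow_pos_of_pos hδ _
  refine ⟨c ^ ℓ * (ε / 2), by positivity, min (T / 2) (δ ^ (p * e)⁻¹), by positivity,
    (min_le_left _ _).trans_lt (by linarith), fun η hη hηr t ht hηt _ => ?_⟩
  have hηδ : η ^ (p * e) ≤ δ := by
    calc η ^ (p * e) ≤ (δ ^ (p * e)⁻¹) ^ (p * e) := by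
          gcongr
          exact hηr.le.trans (min_le_right _ _)
      _ = δ := Real.rpow_inv_rpow hδ.le hpe.ne'
  set N : ℝ := c * η ^ (-e) with hN_def
  have hN : 0 ≤ N := by positivity
  have hNp : η ^ (p * e) * N ^ p = δ := by
    rw [hN_def, Real.mul_rpow hc.le (by positivity), hc_def, Real.rpow_inv_rpow hδ.le hp.ne',
      ← Real.rpow_mul hη.le, mul_left_comm, ← Real.rpow_add hη, show p * e + -e * p = 0 by ring,
      Real.rpow_zero, mul_one]
  have hbound : ∀ᵐ t₀ ∂volume.restrict (Set.Ioc (t - η) t),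
      ENNReal.ofReal (N ^ ℓ) * ENNReal.ofReal (ε / 2) ≤
        ∫⁻ ω, (‖u t₀ ω‖₊ : ℝ≥0∞) ^ ℓ ∂P := by
    rw [← restrict_Ioo_eq_restrict_Ioc, ae_restrict_iff' measurableSet_Ioo]
    filter_upwards [measure_eq_zero_iff_ae_notMem.1 hI₀null] with t₀ hnot hmem
    have ht₀ : 0 < t₀ := by linarith [hmem.1]
    have hI : t₀ ∈ I₀ := by
      by_contra h
      exact hnot ⟨ht₀, h⟩
    obtain ⟨τ, hτ, hcont, hprob⟩ := hloc t₀ hI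
    have hγ : 0 < t - t₀ := sub_pos.2 hmem.2
    have hle := (ofReal_le_measure_le_of_mem_sinSet hε0.le hε1.le ht ht₀.le hmem.2 hτ
      hcont).trans
      (by simpa using hprob (t - t₀) N hγ hN)
    have hsmall : C₀ * (t - t₀) ^ (p * e) * (1 + N ^ p) ≤ ε / 2 := by
      calc C₀ * (t - t₀) ^ (p * e) * (1 + N ^ p) ≤ C₀ * η ^ (p * e) * (1 + N ^ p) := by
            gcongr
            linarith [hmem.1]
        _ = C₀ * η ^ (p * e) + C₀ * (η ^ (p * e) * N ^ p) := by ring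
        _ ≤ C₀ * δ + C₀ * δ := by rw [hNp]; gcongr
        _ = ε / 2 := by rw [hCδ]; ring
    have hhalf : ENNReal.ofReal (ε / 2) ≤ P {ω | N < ‖u t₀ ω‖} := by
      have h := hle.trans (by gcongr :
        _ ≤ ENNReal.ofReal (ε / 2) + P {ω | N < ‖u t₀ ω‖})
      rw [← add_halves ε, ENNReal.ofReal_add (by positivity) (by positivity), add_halves] at h
      exact (ENNReal.add_le_add_iff_left ENNReal.ofReal_ne_top).1 h
    calc ENNReal.ofReal (N ^ ℓ) * ENNReal.ofReal (ε / 2)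
        ≤ ENNReal.ofReal (N ^ ℓ) * P {ω | N < ‖u t₀ ω‖} := by gcongr
      _ ≤ _ := ofReal_rpow_mul_measure_lt_norm_le_lintegral
          (hmeas.comp_measurable measurable_prodMk_left) hN (by linarith)
  calc ENNReal.ofReal (c ^ ℓ * (ε / 2) * η ^ (1 - ℓ * e))
      = ENNReal.ofReal (N ^ ℓ) * ENNReal.ofReal (ε / 2) * ENNReal.ofReal η := by
        rw [← ENNReal.ofReal_mul (by positivity), ← ENNReal.ofReal_mul (by positivity), hN_def,
          Real.mul_rpow hc.le (by positivity), ← Real.rpow_mul hη.le,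
          show 1 - ℓ * e = -e * ℓ + 1 by ring, Real.rpow_add_one hη.ne']
        congr 1
        ring
    _ = ∫⁻ _ in Set.Ioc (t - η) t, ENNReal.ofReal (N ^ ℓ) * ENNReal.ofReal (ε / 2) := by
        simp
    _ ≤ _ := lintegral_mono_ae hbound
end
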